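/- arXiv:2010.01033 — 6 statements merged into one kernel-verified Lean document; each statement's English description precedes it below -/
import Mathlib

section
/- Let φ : ℝⁿ → ℝⁿ be twice continuously differentiable with Jacobian A(q̂)_{ij} = ∂φ_i/∂q̂_j, and define the transformed mass matrix M̂(q̂) = A(q̂)ᵀ M(φ(q̂)) A(q̂) with Christoffel-consistent Coriolis matrix Ĉ° defined from M̂ in the same way C° is defined from M. Define Ȧ(q̂, η)_{βj} = Σ_k (∂²φ_β/∂q̂_j∂q̂_k)(q̂) η_k. Then for all q̂, η ∈ ℝⁿ, Ĉ°(q̂, η) = A(q̂)ᵀ C°(φ(q̂), A(q̂)η) A(q̂) + A(q̂)ᵀ M(φ(q̂)) Ȧ(q̂, η). (Theorem 1: the transformation law for Coriolis matrices maps the Christoffel-consistent factorization in one set of coordinates to the Christoffel-consistent factorization in the transformed coordinates.) -/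
open Matrix BigOperators

/-- Partial derivative of a scalar field on `ι → ℝ` in the `k`-th coordinate direction. -/
noncomputable def pd {ι : Type*} [Fintype ι] [DecidableEq ι]
    (f : (ι → ℝ) → ℝ) (k : ι) (q : ι → ℝ) : ℝ :=
  fderiv ℝ f q (Pi.single k 1)

/-- Christoffel symbols of the first kind of a matrix-valued function `M`. -/
noncomputable def Gamma {ι : Type*} [Fintype ι] [DecidableEq ι]
    (M : (ι → ℝ) → Matrix ι ι ℝ) (q : ι → ℝ) (i j k : ι) : ℝ :=
  (1 / 2) * (pd (fun q => M q i j) k q + pd (fun q => M q i k) j q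
      - pd (fun q => M q j k) i q)

/-- The Christoffel-consistent Coriolis matrix `C°(q, q̇)`. -/
noncomputable def coriolisC {ι : Type*} [Fintype ι] [DecidableEq ι]
    (M : (ι → ℝ) → Matrix ι ι ℝ) (q qd : ι → ℝ) : Matrix ι ι ℝ :=
  Matrix.of fun i j => ∑ k, Gamma M q i j k * qd k

/-- The directional derivative `Ṁ(q, q̇)` of the mass matrix. -/
noncomputable def massDot {ι : Type*} [Fintype ι] [DecidableEq ι]
    (M : (ι → ℝ) → Matrix ι ι ℝ) (q qd : ι → ℝ) : Matrix ι ι ℝ :=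
  Matrix.of fun i j => ∑ k, pd (fun q => M q i j) k q * qd k

/-- Jacobian matrix `A(q̂)_{ij} = ∂φ_i/∂q̂_j` of a change of coordinates `φ`. -/
noncomputable def Jac {n : ℕ} (φ : (Fin n → ℝ) → (Fin n → ℝ)) (qh : Fin n → ℝ) :
    Matrix (Fin n) (Fin n) ℝ :=
  Matrix.of fun i j => pd (fun q => φ q i) j qh

/-- Second partial derivative `∂²φ_β/∂q̂_j∂q̂_k`. -/
noncomputable def secondPD {n : ℕ} (φ : (Fin n → ℝ) → (Fin n → ℝ)) (qh : Fin n → ℝ)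
    (β j k : Fin n) : ℝ :=
  pd (fun q => pd (fun q' => φ q' β) j q) k qh

/-- The matrix `Ȧ(q̂, η)_{βj} = Σ_k (∂²φ_β/∂q̂_j∂q̂_k)(q̂) η_k`. -/
noncomputable def JacDot {n : ℕ} (φ : (Fin n → ℝ) → (Fin n → ℝ)) (qh η : Fin n → ℝ) :
    Matrix (Fin n) (Fin n) ℝ :=
  Matrix.of fun β j => ∑ k, secondPD φ qh β j k * η k

/-- The transformed mass matrix `M̂(q̂) = A(q̂)ᵀ M(φ(q̂)) A(q̂)`. -/
noncomputable def massHat {n : ℕ} (M : (Fin n → ℝ) → Matrix (Fin n) (Fin n) ℝ)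
    (φ : (Fin n → ℝ) → (Fin n → ℝ)) (qh : Fin n → ℝ) : Matrix (Fin n) (Fin n) ℝ :=
  (Jac φ qh)ᵀ * M (φ qh) * Jac φ qh

/-- The chain rule in coordinates. -/
lemma pd_comp_aux {n : ℕ} (f : (Fin n → ℝ) → ℝ) (hf : ContDiff ℝ 1 f)
    (φ : (Fin n → ℝ) → (Fin n → ℝ)) (hφ : ContDiff ℝ 2 φ) (q : Fin n → ℝ) (k : Fin n) :
    pd (fun q => f (φ q)) k q = ∑ c, pd f c (φ q) * Jac φ q c k := by
  have hφd : DifferentiableAt ℝ φ q := (hφ.differentiable (by norm_num)) q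
  have hfd : DifferentiableAt ℝ f (φ q) := (hf.differentiable (by norm_num)) (φ q)
  have h1 : fderiv ℝ (fun q => f (φ q)) q = (fderiv ℝ f (φ q)).comp (fderiv ℝ φ q) :=
    fderiv_comp q hfd hφd
  have h2 : ∀ c, Jac φ q c k = fderiv ℝ φ q (Pi.single k 1) c := by
    intro c
    have := (hasFDerivAt_pi'.1 hφd.hasFDerivAt c).fderiv
    simp only [Jac, pd, Matrix.of_apply]
    rw [this]
    rfl
  simp only [h2]
  unfold pd
  rw [h1, ContinuousLinearMap.comp_apply]
  generalize fderiv ℝ φ q (Pi.single k 1) = v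
  conv_lhs => rw [pi_eq_sum_univ' v, map_sum]
  refine Finset.sum_congr rfl fun c _ => ?_
  rw [map_smul, smul_eq_mul, mul_comm]

lemma contDiff_jac_aux {n : ℕ} (φ : (Fin n → ℝ) → (Fin n → ℝ)) (hφ : ContDiff ℝ 2 φ)
    (i j : Fin n) : ContDiff ℝ 1 (fun q => Jac φ q i j) := by
  have h : ContDiff ℝ 2 (fun q => φ q i) := contDiff_pi.1 hφ i
  have h' : ContDiff ℝ 1 (fderiv ℝ (fun q => φ q i)) := h.fderiv_right (by norm_num)
  exact h'.clm_apply contDiff_const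

lemma secondPD_symm_aux {n : ℕ} (φ : (Fin n → ℝ) → (Fin n → ℝ)) (hφ : ContDiff ℝ 2 φ)
    (q : Fin n → ℝ) (b j k : Fin n) : secondPD φ q b j k = secondPD φ q b k j := by
  have h : ContDiff ℝ 2 (fun q => φ q b) := contDiff_pi.1 hφ b
  have h' : ContDiff ℝ 1 (fderiv ℝ (fun q => φ q b)) := h.fderiv_right (by norm_num)
  have hd : DifferentiableAt ℝ (fderiv ℝ (fun q => φ q b)) q :=
    (h'.differentiable (by norm_num)) q
  have key : ∀ j k, secondPD φ q b j k
      = fderiv ℝ (fderiv ℝ (fun q => φ q b)) q (Pi.single k 1) (Pi.single j 1) := by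
    intro j k
    unfold secondPD pd
    rw [fderiv_clm_apply hd (differentiableAt_const _)]
    simp
  rw [key, key]
  exact (h.contDiffAt.isSymmSndFDerivAt (by simp)) _ _

lemma swap3_aux {n : ℕ} (f : Fin n → Fin n → Fin n → ℝ) :
    ∑ b, ∑ a, ∑ k, f b a k = ∑ k, ∑ a, ∑ b, f b a k := by
  rw [Finset.sum_comm, Finset.sum_comm (s := Finset.univ) (f := fun k a => ∑ b, f b a k)]
  exact Finset.sum_congr rfl fun a _ => Finset.sum_comm

lemma pd_massHat_aux {n : ℕ}
    (M : (Fin n → ℝ) → Matrix (Fin n) (Fin n) ℝ)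
    (hM : ∀ i j, ContDiff ℝ 1 fun q => M q i j)
    (φ : (Fin n → ℝ) → (Fin n → ℝ))
    (hφ : ContDiff ℝ 2 φ) (q : Fin n → ℝ) (i j k : Fin n) :
    pd (fun q => massHat M φ q i j) k q
      = ∑ b, ∑ a, (Jac φ q a i * (∑ c, pd (fun q => M q a b) c (φ q) * Jac φ q c k) * Jac φ q b j
          + secondPD φ q a i k * M (φ q) a b * Jac φ q b j
          + Jac φ q a i * M (φ q) a b * secondPD φ q b j k) := by
  have hJ : ∀ a i, DifferentiableAt ℝ (fun q => Jac φ q a i) q := fun a i =>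
    ((contDiff_jac_aux φ hφ a i).differentiable (by norm_num)) q
  have hMd : ∀ a b, DifferentiableAt ℝ (fun q => M (φ q) a b) q := fun a b =>
    (((hM a b).comp (hφ.of_le (by norm_num))).differentiable (by norm_num)) q
  have e : (fun q => massHat M φ q i j)
      = fun q => ∑ b, ∑ a, Jac φ q a i * M (φ q) a b * Jac φ q b j := by
    funext q
    simp [massHat, Matrix.mul_apply, Finset.sum_mul]
  have hd : HasFDerivAt (fun q => ∑ b, ∑ a, Jac φ q a i * M (φ q) a b * Jac φ q b j) _ q :=
    HasFDerivAt.fun_sum fun b _ => HasFDerivAt.fun_sum fun a _ =>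
      (((hJ a i).hasFDerivAt.mul (hMd a b).hasFDerivAt).mul (hJ b j).hasFDerivAt)
  rw [e]
  unfold pd
  rw [hd.fderiv]
  simp only [_root_.sum_apply]
  refine Finset.sum_congr rfl fun b _ => Finset.sum_congr rfl fun a _ => ?_
  have h1 := pd_comp_aux _ (hM a b) φ hφ q k
  have h2 : ∀ a i, fderiv ℝ (fun q => Jac φ q a i) q (Pi.single k 1) = secondPD φ q a i k :=
    fun _ _ => rfl
  unfold pd at h1
  simp only [_root_.add_apply, _root_.smul_apply, Pi.mul_apply, smul_eq_mul, h2, h1]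
  ring

/-- Theorem 1: the Coriolis transformation law carries the Christoffel-consistent
factorization of `M` to the Christoffel-consistent factorization of
`M̂ = AᵀMA`:  `Ĉ°(q̂,η) = A(q̂)ᵀ C°(φ(q̂), A(q̂)η) A(q̂) + A(q̂)ᵀ M(φ(q̂)) Ȧ(q̂,η)`. -/
theorem coriolisC_change_of_coordinates {n : ℕ} (hn : 0 < n)
    (M : (Fin n → ℝ) → Matrix (Fin n) (Fin n) ℝ)
    (hM : ∀ i j, ContDiff ℝ 1 fun q => M q i j)
    (hsymm : ∀ q, (M q).IsSymm)
    (φ : (Fin n → ℝ) → (Fin n → ℝ))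
    (hφ : ContDiff ℝ 2 φ) :
    ∀ qh η : Fin n → ℝ,
      coriolisC (massHat M φ) qh η
        = (Jac φ qh)ᵀ * coriolisC M (φ qh) (Jac φ qh *ᵥ η) * Jac φ qh
          + (Jac φ qh)ᵀ * M (φ qh) * JacDot φ qh η := by
  intro qh η
  have hS := secondPD_symm_aux φ hφ qh
  have hD : ∀ a b c, pd (fun q => M q a b) c (φ qh) = pd (fun q => M q b a) c (φ qh) := by
    intro a b c
    congr 1
    funext q
    exact (hsymm q).apply b a
  have hMs : ∀ a b, M (φ qh) a b = M (φ qh) b a := fun a b => (hsymm _).apply b a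
  have hpd := pd_massHat_aux M hM φ hφ qh
  generalize hA : Jac φ qh = A at *
  generalize hm : M (φ qh) = m at *
  obtain ⟨D, hDd⟩ : ∃ D : Fin n → Fin n → Fin n → ℝ,
    ∀ a b c, pd (fun q => M q a b) c (φ qh) = D a b c := ⟨_, fun _ _ _ => rfl⟩
  obtain ⟨S, hSd⟩ : ∃ S : Fin n → Fin n → Fin n → ℝ,
    ∀ a b c, secondPD φ qh a b c = S a b c := ⟨_, fun _ _ _ => rfl⟩
  simp only [hDd, hSd] at hS hD hpd
  obtain ⟨T, hT⟩ : ∃ T : Fin n → Fin n → Fin n → ℝ,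
    ∀ i j k, T i j k = ∑ a, ∑ b, ∑ c, D a b c * A a i * A b j * A c k := ⟨_, fun _ _ _ => rfl⟩
  obtain ⟨U, hU⟩ : ∃ U : Fin n → Fin n → Fin n → ℝ,
    ∀ i j k, U i j k = ∑ a, ∑ b, A a i * m a b * S b j k := ⟨_, fun _ _ _ => rfl⟩
  have hUs : ∀ i j k, U i j k = U i k j := by
    intro i j k
    simp only [hU]
    exact Finset.sum_congr rfl fun a _ => Finset.sum_congr rfl fun b _ => by rw [hS]
  have hpd2 : ∀ i j k, pd (fun q => massHat M φ q i j) k qh = T i j k + U j i k + U i j k := by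
    intro i j k
    rw [hpd, hT, hU, hU]
    rw [Finset.sum_comm (f := fun a b => A a i * m a b * S b j k),
      Finset.sum_comm (f := fun a b => ∑ c, D a b c * A a i * A b j * A c k)]
    simp only [← Finset.sum_add_distrib]
    refine Finset.sum_congr rfl fun b _ => Finset.sum_congr rfl fun a _ => ?_
    rw [hMs b a, Finset.mul_sum, Finset.sum_mul]
    have : ∑ c, A a i * (D a b c * A c k) * A b j = ∑ c, D a b c * A a i * A b j * A c k :=
      Finset.sum_congr rfl fun c _ => by ring
    rw [this]
    ring
  have hG : ∀ i j k, ∑ a, ∑ b, ∑ c, (1 / 2) * (D a b c + D a c b - D b c a)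
        * A a i * A b j * A c k = (1 / 2) * (T i j k + T i k j - T j k i) := by
    intro i j k
    have e2 : T i k j = ∑ a, ∑ b, ∑ c, D a c b * A a i * A b j * A c k := by
      rw [hT]
      refine Finset.sum_congr rfl fun a _ => ?_
      rw [Finset.sum_comm]
      exact Finset.sum_congr rfl fun b _ => Finset.sum_congr rfl fun c _ => by ring
    have e3 : T j k i = ∑ a, ∑ b, ∑ c, D b c a * A a i * A b j * A c k := by
      rw [hT, Finset.sum_comm' (s' := fun _ => Finset.univ) (t' := Finset.univ) (by simp)]
      rw [Finset.sum_comm]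
      have : ∀ b, ∑ c, ∑ a, D b c a * A b j * A c k * A a i
          = ∑ a, ∑ c, D b c a * A a i * A b j * A c k := by
        intro b
        rw [Finset.sum_comm]
        exact Finset.sum_congr rfl fun b _ => Finset.sum_congr rfl fun c _ => by ring
      simp only [this]
      rw [Finset.sum_comm]
    rw [e2, e3, hT]
    simp only [← Finset.sum_add_distrib, ← Finset.sum_sub_distrib, Finset.mul_sum]
    exact Finset.sum_congr rfl fun a _ => Finset.sum_congr rfl fun b _ =>
      Finset.sum_congr rfl fun c _ => by ring
  ext i j
  have hL : coriolisC (massHat M φ) qh η i j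
      = ∑ k, ((1 / 2) * (T i j k + T i k j - T j k i) * η k + U i j k * η k) := by
    simp only [coriolisC, Matrix.of_apply, Gamma, hpd2]
    refine Finset.sum_congr rfl fun k _ => ?_
    rw [hUs k i j, hUs j k i, hUs i k j]
    ring
  have hR2 : (Aᵀ * m * JacDot φ qh η) i j = ∑ k, U i j k * η k := by
    simp only [Matrix.mul_apply, JacDot, Matrix.of_apply, Matrix.transpose_apply, hU, hSd,
      Finset.sum_mul_sum]
    simp only [Finset.sum_mul]
    rw [swap3_aux]
    exact Finset.sum_congr rfl fun k _ => Finset.sum_congr rfl fun a _ =>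
      Finset.sum_congr rfl fun b _ => by ring
  have hR1 : (Aᵀ * coriolisC M (φ qh) (A *ᵥ η) * A) i j
      = ∑ k, (1 / 2) * (T i j k + T i k j - T j k i) * η k := by
    have e : (Aᵀ * coriolisC M (φ qh) (A *ᵥ η) * A) i j
        = ∑ b, ∑ a, ∑ k, ∑ c, (1 / 2) * (D a b c + D a c b - D b c a)
          * A a i * A b j * A c k * η k := by
      simp only [Matrix.mul_apply, coriolisC, Gamma, Matrix.of_apply, Matrix.transpose_apply,
        hDd, Matrix.mulVec, dotProduct]
      refine Finset.sum_congr rfl fun b _ => ?_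
      rw [Finset.sum_mul]
      refine Finset.sum_congr rfl fun a _ => ?_
      rw [Finset.sum_comm, Finset.mul_sum, Finset.sum_mul]
      refine Finset.sum_congr rfl fun c _ => ?_
      rw [Finset.mul_sum, Finset.mul_sum, Finset.sum_mul]
      exact Finset.sum_congr rfl fun k _ => by ring
    rw [e, swap3_aux]
    refine Finset.sum_congr rfl fun k _ => ?_
    rw [← hG]
    simp only [Finset.sum_mul]
  rw [hL, Matrix.add_apply, hR1, hR2, Finset.sum_add_distrib]
end

section
/- Let φ : ℝⁿ → ℝⁿ be twice continuously differentiable with Jacobian A(q̂)_{ij} = ∂φ_i/∂q̂_j, let Ȧ(q̂, η)_{βj} = Σ_k (∂²φ_β/∂q̂_j∂q̂_k)(q̂) η_k, let M̂(q̂) = A(q̂)ᵀ M(φ(q̂)) A(q̂), and given C : ℝⁿ × ℝⁿ → Matrix ℝ n n define Ĉ(q̂, η) = A(q̂)ᵀ C(φ(q̂), A(q̂)η) A(q̂) + A(q̂)ᵀ M(φ(q̂)) Ȧ(q̂, η). If C is an admissible Coriolis factorization for M, then Ĉ is an admissible Coriolis factorization for M̂; that is, Ĉ(q̂, η) η = Ĉ°(q̂,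 η) η for all q̂, η (where Ĉ° is the Christoffel-consistent Coriolis matrix of M̂), and M̂̇(q̂, η) = Ĉ(q̂, η) + Ĉ(q̂, η)ᵀ for all q̂, η, where M̂̇(q̂, η)_{ij} = Σ_k (∂M̂_{ij}/∂q̂_k)(q̂) η_k. (Proposition 3: admissible factorizations are preserved under a change of coordinates.) -/
open Matrix BigOperators

/-- The transformed Coriolis matrix
`Ĉ(q̂,η) = A(q̂)ᵀ C(φ(q̂), A(q̂)η) A(q̂) + A(q̂)ᵀ M(φ(q̂)) Ȧ(q̂,η)`. -/
noncomputable def coriolisHat {n : ℕ}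
    (M : (Fin n → ℝ) → Matrix (Fin n) (Fin n) ℝ)
    (C : (Fin n → ℝ) → (Fin n → ℝ) → Matrix (Fin n) (Fin n) ℝ)
    (φ : (Fin n → ℝ) → (Fin n → ℝ)) (qh η : Fin n → ℝ) : Matrix (Fin n) (Fin n) ℝ :=
  (Jac φ qh)ᵀ * C (φ qh) (Jac φ qh *ᵥ η) * Jac φ qh
    + (Jac φ qh)ᵀ * M (φ qh) * JacDot φ qh η

theorem aux_sum_pd {ι : Type*} [Fintype ι] [DecidableEq ι]
    (f : (ι → ℝ) → ℝ) (q v : ι → ℝ) : ∑ k, pd f k q * v k = fderiv ℝ f q v := by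
  conv_rhs => rw [pi_eq_sum_univ' v]
  simp [pd, mul_comm]

theorem aux_massDot {ι : Type*} [Fintype ι] [DecidableEq ι]
    (M : (ι → ℝ) → Matrix ι ι ℝ) (q v : ι → ℝ) (i j : ι) :
    massDot M q v i j = fderiv ℝ (fun q => M q i j) q v := by
  simp only [massDot, Matrix.of_apply, aux_sum_pd]

theorem aux_coriolis {ι : Type*} [Fintype ι] [DecidableEq ι]
    (M : (ι → ℝ) → Matrix ι ι ℝ) (q v : ι → ℝ) (i : ι) :
    (coriolisC M q v *ᵥ v) i = (massDot M q v *ᵥ v) i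
      - (1 / 2) * (v ⬝ᵥ (massDot M q (Pi.single i 1) *ᵥ v)) := by
  have h3 : ∀ j k, massDot M q (Pi.single i 1) j k = pd (fun q => M q j k) i q := by
    intro j k; rw [aux_massDot]; rfl
  simp only [Matrix.mulVec, dotProduct, h3]
  have e : ∑ j, ∑ k, pd (fun q => M q i j) k q * v k * v j
      = ∑ j, ∑ k, pd (fun q => M q i k) j q * v k * v j := by
    rw [Finset.sum_comm]
    refine Finset.sum_congr rfl fun a _ => Finset.sum_congr rfl fun b _ => by ring
  have e1 : ∑ j, coriolisC M q v i j * v j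
      = (1/2) * (∑ j, ∑ k, pd (fun q => M q i j) k q * v k * v j)
      + (1/2) * (∑ j, ∑ k, pd (fun q => M q i k) j q * v k * v j)
      - (1/2) * ∑ j, v j * ∑ k, pd (fun q => M q j k) i q * v k := by
    simp only [coriolisC, Gamma, Matrix.of_apply, Finset.mul_sum, Finset.sum_mul,
      ← Finset.sum_add_distrib, ← Finset.sum_sub_distrib]
    refine Finset.sum_congr rfl fun a _ => Finset.sum_congr rfl fun b _ => by ring
  rw [e1, ← e]
  simp only [massDot, Matrix.of_apply, Finset.sum_mul]
  ring

theorem aux_comp {n : ℕ} {φ : (Fin n → ℝ) → (Fin n → ℝ)} (hφ : ContDiff ℝ 2 φ) (i : Fin n) :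
    ContDiff ℝ 2 (fun q => φ q i) := by
  fun_prop

theorem aux_jac_diff {n : ℕ} {φ : (Fin n → ℝ) → (Fin n → ℝ)} (hφ : ContDiff ℝ 2 φ)
    (i j : Fin n) : Differentiable ℝ (fun q => Jac φ q i j) := by
  have h := (aux_comp hφ i).fderiv_right (m := 1) (by norm_num)
  have h2 := h.differentiable (by norm_num)
  show Differentiable ℝ (fun q => fderiv ℝ (fun q => φ q i) q (Pi.single j 1))
  fun_prop

theorem aux_jacDot {n : ℕ} (φ : (Fin n → ℝ) → (Fin n → ℝ)) (q η : Fin n → ℝ) (i j : Fin n) :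
    JacDot φ q η i j = fderiv ℝ (fun q => Jac φ q i j) q η := by
  simp only [JacDot, secondPD, Matrix.of_apply, aux_sum_pd, Jac]

theorem aux_secondPD_symm {n : ℕ} {φ : (Fin n → ℝ) → (Fin n → ℝ)} (hφ : ContDiff ℝ 2 φ)
    (q : Fin n → ℝ) (b j k : Fin n) : secondPD φ q b j k = secondPD φ q b k j := by
  have h := (aux_comp hφ b).fderiv_right (m := 1) (by norm_num)
  have h2 := h.differentiable (by norm_num)
  have hs : IsSymmSndFDerivAt ℝ (fun q => φ q b) q :=
    (aux_comp hφ b).contDiffAt.isSymmSndFDerivAt (by simp)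
  have key : ∀ j k, secondPD φ q b j k
      = fderiv ℝ (fderiv ℝ (fun q => φ q b)) q (Pi.single k 1) (Pi.single j 1) := by
    intro j k
    simp only [secondPD, pd]
    rw [fderiv_clm_apply (h2 q) (by fun_prop)]
    simp
  rw [key, key]
  exact hs _ _

theorem aux_jac_mulVec {n : ℕ} {φ : (Fin n → ℝ) → (Fin n → ℝ)} (hφ : ContDiff ℝ 2 φ)
    (q η : Fin n → ℝ) : Jac φ q *ᵥ η = fderiv ℝ φ q η := by
  ext i
  have hd : DifferentiableAt ℝ φ q := hφ.differentiable (by norm_num) q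
  simp only [Matrix.mulVec, dotProduct, Jac, Matrix.of_apply, aux_sum_pd]
  rw [fderiv_apply hd]
  rfl

theorem aux_massDot_hat {n : ℕ}
    (M : (Fin n → ℝ) → Matrix (Fin n) (Fin n) ℝ)
    (hM : ∀ i j, ContDiff ℝ 1 fun q => M q i j)
    (φ : (Fin n → ℝ) → (Fin n → ℝ)) (hφ : ContDiff ℝ 2 φ) (q η : Fin n → ℝ) :
    massDot (massHat M φ) q η = (JacDot φ q η)ᵀ * M (φ q) * Jac φ q
      + (Jac φ q)ᵀ * massDot M (φ q) (Jac φ q *ᵥ η) * Jac φ q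
      + (Jac φ q)ᵀ * M (φ q) * JacDot φ q η := by
  ext i j
  have hd : DifferentiableAt ℝ φ q := hφ.differentiable (by norm_num) q
  have hA : ∀ a b, HasFDerivAt (fun q => Jac φ q a b) (fderiv ℝ (fun q => Jac φ q a b) q) q :=
    fun a b => (aux_jac_diff hφ a b q).hasFDerivAt
  have hMφ : ∀ a b, HasFDerivAt (fun q => M (φ q) a b)
      ((fderiv ℝ (fun q => M q a b) (φ q)).comp (fderiv ℝ φ q)) q := fun a b =>
    ((hM a b).differentiable (by norm_num) (φ q)).hasFDerivAt.comp q hd.hasFDerivAt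
  have hh := HasFDerivAt.fun_sum (u := Finset.univ) (fun b (_ : b ∈ Finset.univ) =>
    (HasFDerivAt.fun_sum (u := Finset.univ) (fun a (_ : a ∈ Finset.univ) =>
      (hA a i).mul (hMφ a b))).mul (hA b j))
  rw [aux_massDot]
  have : (fun q => massHat M φ q i j)
      = fun q => ∑ b, (∑ a, Jac φ q a i * M (φ q) a b) * Jac φ q b j := by
    ext q; simp [massHat, Matrix.mul_apply]
  rw [this]
  erw [hh.fderiv]
  simp only [Matrix.add_apply, Matrix.mul_apply, Matrix.transpose_apply, aux_massDot,
    aux_jacDot, aux_jac_mulVec hφ, ← Finset.sum_add_distrib]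
  simp only [ContinuousLinearMap.sum_apply, ContinuousLinearMap.add_apply,
    ContinuousLinearMap.smul_apply, ContinuousLinearMap.comp_apply, smul_eq_mul]
  refine Finset.sum_congr rfl fun b _ => ?_
  simp only [Finset.mul_sum, Finset.sum_mul, ← Finset.sum_add_distrib]
  refine Finset.sum_congr rfl fun a _ => ?_
  simp only [Pi.mul_apply]
  ring

theorem aux_quad {n : ℕ} (M : (Fin n → ℝ) → Matrix (Fin n) (Fin n) ℝ)
    (q v w : Fin n → ℝ) : v ⬝ᵥ (massDot M q w *ᵥ v)
      = ∑ k, w k * (v ⬝ᵥ (massDot M q (Pi.single k 1) *ᵥ v)) := by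
  have h : massDot M q w = ∑ k, w k • massDot M q (Pi.single k 1) := by
    ext i j
    simp only [Matrix.sum_apply, Matrix.smul_apply, aux_massDot, smul_eq_mul]
    rw [← aux_sum_pd]
    exact Finset.sum_congr rfl fun k _ => mul_comm _ _
  rw [h, Matrix.sum_mulVec, dotProduct_sum]
  simp [Matrix.smul_mulVec]

/-- Proposition 3: if `C` is an admissible Coriolis factorization for `M`, then
`Ĉ` is an admissible Coriolis factorization for `M̂ = AᵀMA`:  it is valid for `M̂`
and satisfies `dM̂/dt(q̂,η) = Ĉ(q̂,η) + Ĉ(q̂,η)ᵀ`. -/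
theorem admissible_change_of_coordinates {n : ℕ} (hn : 0 < n)
    (M : (Fin n → ℝ) → Matrix (Fin n) (Fin n) ℝ)
    (hM : ∀ i j, ContDiff ℝ 1 fun q => M q i j)
    (hsymm : ∀ q, (M q).IsSymm)
    (φ : (Fin n → ℝ) → (Fin n → ℝ))
    (hφ : ContDiff ℝ 2 φ)
    (C : (Fin n → ℝ) → (Fin n → ℝ) → Matrix (Fin n) (Fin n) ℝ)
    (hvalid : ∀ q qd, C q qd *ᵥ qd = coriolisC M q qd *ᵥ qd)
    (hadm : ∀ q qd, massDot M q qd = C q qd + (C q qd)ᵀ) :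
    ∀ qh η : Fin n → ℝ,
      coriolisHat M C φ qh η *ᵥ η = coriolisC (massHat M φ) qh η *ᵥ η ∧
      massDot (massHat M φ) qh η
        = coriolisHat M C φ qh η + (coriolisHat M C φ qh η)ᵀ := by
  intro qh η
  have hdot := aux_massDot_hat M hM φ hφ qh
  have hMs : (M (φ qh))ᵀ = M (φ qh) := hsymm (φ qh)
  constructor
  · ext i
    rw [aux_coriolis, hdot, hdot]
    simp only [coriolisHat]
    set A := Jac φ qh with hAdef
    set v := A *ᵥ η with hv
    set N := M (φ qh) with hN
    have hJ : JacDot φ qh (Pi.single i 1) *ᵥ η = fun b => JacDot φ qh η b i := by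
      ext b
      simp only [Matrix.mulVec, dotProduct, JacDot, Matrix.of_apply]
      refine Finset.sum_congr rfl fun k _ => ?_
      rw [aux_secondPD_symm hφ qh b i k]
      simp [Pi.single_apply]
    have hq : ∀ B : Matrix (Fin n) (Fin n) ℝ, ∀ u : Fin n → ℝ,
        η ⬝ᵥ (Bᵀ *ᵥ u) = (B *ᵥ η) ⬝ᵥ u := by
      intro B u
      rw [Matrix.dotProduct_mulVec, Matrix.vecMul_transpose]
    have hc : C (φ qh) v *ᵥ v = coriolisC M (φ qh) v *ᵥ v := hvalid _ _
    have hN2 : v ⬝ᵥ (N *ᵥ fun b => JacDot φ qh η b i)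
        = (fun b => JacDot φ qh η b i) ⬝ᵥ (N *ᵥ v) := by
      rw [Matrix.dotProduct_mulVec, ← Matrix.mulVec_transpose, hMs, dotProduct_comm]
    have hl : (((JacDot φ qh η)ᵀ *ᵥ (N *ᵥ v)) i)
        = (fun b => JacDot φ qh η b i) ⬝ᵥ (N *ᵥ v) := rfl
    have hA1 : (Aᵀ *ᵥ (coriolisC M (φ qh) v *ᵥ v)) i
        = (Aᵀ *ᵥ (massDot M (φ qh) v *ᵥ v)) i
          - (1 / 2) * (v ⬝ᵥ (massDot M (φ qh) (A *ᵥ Pi.single i 1) *ᵥ v)) := by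
      rw [aux_quad M (φ qh) v (A *ᵥ Pi.single i 1), Finset.mul_sum]
      simp only [Matrix.mulVec_single_one, Matrix.col_apply]
      show ∑ k, A k i * _ = ∑ k, A k i * _ - _
      rw [← Finset.sum_sub_distrib]
      refine Finset.sum_congr rfl fun k _ => ?_
      rw [aux_coriolis]
      ring
    simp only [Matrix.add_mulVec, ← Matrix.mulVec_mulVec, ← hv, hc, Pi.add_apply,
      dotProduct_add, hq, hJ, hA1, hl, hN2]
    ring
  · rw [hdot, hadm]
    simp only [coriolisHat, Matrix.transpose_add, Matrix.transpose_mul,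
      Matrix.transpose_transpose, hMs, Matrix.mul_add, Matrix.add_mul, Matrix.mul_assoc]
    abel
end

section
/- Let C : ℝⁿ × ℝⁿ → Matrix ℝ n n be any valid Coriolis factorization. Then for every fixed q ∈ ℝⁿ the map v ↦ C(q, v) v from ℝⁿ to ℝⁿ is differentiable, and its Fréchet derivative at any point q̇ is the linear map w ↦ 2 C°(q, q̇) w. In particular C°(q, q̇) = (1/2) ∂/∂q̇ [C(q, q̇) q̇]. -/
open Matrix BigOperators

/-- If `C` is any valid Coriolis factorization, then for each fixed `q` the map
`v ↦ C(q,v) v` is differentiable with Fréchet derivative at `q̇` equal to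
`w ↦ 2 C°(q,q̇) w`; in particular `C°(q,q̇) = (1/2) ∂/∂q̇ [C(q,q̇) q̇]`. -/
theorem coriolisC_eq_half_fderiv {n : ℕ} (hn : 0 < n)
    (M : (Fin n → ℝ) → Matrix (Fin n) (Fin n) ℝ)
    (hM : ∀ i j, ContDiff ℝ 1 fun q => M q i j)
    (hsymm : ∀ q, (M q).IsSymm)
    (C : (Fin n → ℝ) → (Fin n → ℝ) → Matrix (Fin n) (Fin n) ℝ)
    (hvalid : ∀ q qd, C q qd *ᵥ qd = coriolisC M q qd *ᵥ qd) :
    ∀ q qd : Fin n → ℝ,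
      HasFDerivAt (fun v : Fin n → ℝ => C q v *ᵥ v)
        (LinearMap.toContinuousLinearMap ((2 : ℝ) • (coriolisC M q qd).mulVecLin)) qd := by
  intro q qd
  have hG : ∀ i j k, Gamma M q i j k = Gamma M q i k j := by
    intro i j k
    have h : (fun q => M q j k) = fun q => M q k j := by
      funext x
      exact (hsymm x).apply k j
    unfold Gamma
    rw [h]
    ring
  simp only [hvalid]
  rw [hasFDerivAt_pi']
  intro i
  have hp : ∀ k : Fin n, HasFDerivAt (fun v : Fin n → ℝ => v k)
      (ContinuousLinearMap.proj (R := ℝ) (φ := fun _ : Fin n => ℝ) k) qd :=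
    fun k => hasFDerivAt_apply k qd
  have h1 : HasFDerivAt (fun v : Fin n → ℝ => ∑ j, (∑ k, Gamma M q i j k * v k) * v j)
      _ qd :=
    HasFDerivAt.fun_sum (u := Finset.univ) fun j _ =>
      (HasFDerivAt.fun_sum (u := Finset.univ) fun k _ =>
        (hp k).const_mul (Gamma M q i j k)).mul (hp j)
  refine h1.congr_fderiv ?_
  ext1 w
  have h2 : ∑ j, qd j * ∑ k, Gamma M q i j k * w k
      = ∑ j, (∑ k, Gamma M q i j k * qd k) * w j := by
    simp only [Finset.mul_sum, Finset.sum_mul]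
    rw [Finset.sum_comm]
    refine Finset.sum_congr rfl fun j _ => Finset.sum_congr rfl fun k _ => ?_
    rw [hG i k j]
    ring
  have h3 : ((2 : ℝ) • (coriolisC M q qd).mulVecLin) w i
      = 2 * ∑ j, (∑ k, Gamma M q i j k * qd k) * w j := by
    simp [coriolisC, Matrix.mulVec, dotProduct]
  change _ = ((2 : ℝ) • (coriolisC M q qd).mulVecLin) w i
  rw [h3, two_mul]
  nth_rewrite 2 [← h2]
  simp [Finset.sum_add_distrib]
end

section
/- The Christoffel-consistent factorization is the unique valid Coriolis factorization whose coefficient tensor is symmetric in its last two indices: if T : ℝⁿ → (Fin n → Fin n → Fin n → ℝ) satisfies T_{ijk}(q) = T_{ikj}(q) for all q, i, j, k, and the matrix function C(q, q̇)_{ij} = Σ_k T_{ijk}(q) q̇_k is a valid Coriolis factorization, then T_{ijk}(q) = Γ_{ijk}(q) for all q, i, j, k, and hence C = C°. -/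
open Matrix BigOperators

theorem quad_eq_of_symm {n : ℕ} (A B : Fin n → Fin n → ℝ)
    (hA : ∀ j k, A j k = A k j) (hB : ∀ j k, B j k = B k j)
    (h : ∀ x : Fin n → ℝ, ∑ j, (∑ k, A j k * x k) * x j = ∑ j, (∑ k, B j k * x k) * x j)
    (j k : Fin n) : A j k = B j k := by
  have h1 := h (Pi.single j 1)
  have h2 := h (Pi.single k 1)
  have h3 := h (Pi.single j 1 + Pi.single k 1)
  simp only [Pi.add_apply, mul_add, Finset.sum_add_distrib, Pi.single_apply, mul_ite, mul_one,
    mul_zero, Finset.sum_ite_eq', Finset.sum_ite_eq, Finset.mem_univ, if_true] at h1 h2 h3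
  have := hA j k
  have := hB j k
  linarith

/-- Uniqueness of the Christoffel-consistent factorization: if a coefficient tensor
`T` is symmetric in its last two indices and `C(q,q̇)_{ij} = Σ_k T_{ijk}(q) q̇_k` is a
valid Coriolis factorization, then `T = Γ` (and hence `C = C°`). -/
theorem christoffel_unique {n : ℕ} (hn : 0 < n)
    (M : (Fin n → ℝ) → Matrix (Fin n) (Fin n) ℝ)
    (hM : ∀ i j, ContDiff ℝ 1 fun q => M q i j)
    (hsymm : ∀ q, (M q).IsSymm)
    (T : (Fin n → ℝ) → Fin n → Fin n → Fin n → ℝ)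
    (hT : ∀ q i j k, T q i j k = T q i k j)
    (hvalid : ∀ q qd : Fin n → ℝ,
      (Matrix.of fun i j => ∑ k, T q i j k * qd k) *ᵥ qd = coriolisC M q qd *ᵥ qd) :
    (∀ q i j k, T q i j k = Gamma M q i j k) ∧
    (∀ q qd : Fin n → ℝ,
      (Matrix.of fun i j => ∑ k, T q i j k * qd k) = coriolisC M q qd) := by
  have key : ∀ q i j k, T q i j k = Gamma M q i j k := by
    intro q i j k
    refine quad_eq_of_symm (T q i) (Gamma M q i) (hT q i) ?_ ?_ j k
    · intro j k
      have e : (fun q => M q j k) = fun q => M q k j := by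
        funext q
        exact (hsymm q).apply k j
      unfold Gamma
      rw [e]
      ring
    · intro x
      have := congrFun (hvalid q x) i
      simpa [Matrix.mulVec, dotProduct, coriolisC] using this
  refine ⟨key, fun q qd => ?_⟩
  ext i j
  simp [coriolisC, key]
end

section
/- For every v ∈ ℝ⁶ and every 6×6 real matrix I, the Niemeyer–Slotine body-level factorization satisfies B(v, I) v = (v×*)(I v); that is, it reproduces the spatial velocity-product force v×* I v. -/
open Matrix BigOperators

/-- The 3×3 skew-symmetric cross-product matrix `S(p)` with `S(p) x = p × x`. -/
def skew3 (p : Fin 3 → ℝ) : Matrix (Fin 3) (Fin 3) ℝ :=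
  !![0, -p 2, p 1; p 2, 0, -p 0; -p 1, p 0, 0]

/-- Spatial vectors `ℝ⁶ ≅ ℝ³ × ℝ³`, indexed by `Fin 3 ⊕ Fin 3`
(first block: angular part `ω` / moment `n`, second block: linear part `u` / force `F`). -/
abbrev SpatialVec := Fin 3 ⊕ Fin 3 → ℝ

/-- The spatial motion/motion cross-product matrix `(v×) = [[S(ω), 0],[S(u), S(ω)]]`. -/
def crossM (v : SpatialVec) : Matrix (Fin 3 ⊕ Fin 3) (Fin 3 ⊕ Fin 3) ℝ :=
  Matrix.fromBlocks (skew3 (v ∘ Sum.inl)) 0 (skew3 (v ∘ Sum.inr)) (skew3 (v ∘ Sum.inl))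

/-- The spatial motion/force cross-product matrix `(v×*) = −(v×)ᵀ`. -/
def crossF (v : SpatialVec) : Matrix (Fin 3 ⊕ Fin 3) (Fin 3 ⊕ Fin 3) ℝ :=
  -(crossM v)ᵀ

/-- The swapped cross-product matrix `(f ×̄*) = [[−S(n), −S(F)],[−S(F), 0]]`. -/
def crossBar (f : SpatialVec) : Matrix (Fin 3 ⊕ Fin 3) (Fin 3 ⊕ Fin 3) ℝ :=
  Matrix.fromBlocks (-skew3 (f ∘ Sum.inl)) (-skew3 (f ∘ Sum.inr))
    (-skew3 (f ∘ Sum.inr)) 0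

/-- The Niemeyer–Slotine body-level factorization
`B(v, I) = (1/2)[(v×*) I + ((I v) ×̄*) − I (v×)]`. -/
noncomputable def nsB (v : SpatialVec) (I : Matrix (Fin 3 ⊕ Fin 3) (Fin 3 ⊕ Fin 3) ℝ) :
    Matrix (Fin 3 ⊕ Fin 3) (Fin 3 ⊕ Fin 3) ℝ :=
  (1 / 2 : ℝ) • (crossF v * I + crossBar (I *ᵥ v) - I * crossM v)

theorem crossBar_mulVec_aux (f v : SpatialVec) : crossBar f *ᵥ v = crossF v *ᵥ f := by
  ext i
  rcases i with i | i <;> fin_cases i <;>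
    simp [crossBar, crossF, crossM, skew3, Matrix.mulVec, dotProduct, Fin.sum_univ_three] <;> ring

theorem crossM_mulVec_self_aux (v : SpatialVec) : crossM v *ᵥ v = 0 := by
  ext i
  rcases i with i | i <;> fin_cases i <;>
    simp [crossM, skew3, Matrix.mulVec, dotProduct, Fin.sum_univ_three] <;> ring

/-- The Niemeyer–Slotine factorization reproduces the spatial velocity-product force:
`B(v, I) v = (v×*)(I v)` for every `v ∈ ℝ⁶` and every 6×6 matrix `I`. -/
theorem nsB_mulVec_self (v : SpatialVec) (I : Matrix (Fin 3 ⊕ Fin 3) (Fin 3 ⊕ Fin 3) ℝ) :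
    nsB v I *ᵥ v = crossF v *ᵥ (I *ᵥ v) := by
  rw [nsB, Matrix.smul_mulVec, Matrix.sub_mulVec, Matrix.add_mulVec, crossBar_mulVec_aux,
    ← Matrix.mulVec_mulVec, ← Matrix.mulVec_mulVec, crossM_mulVec_self_aux, Matrix.mulVec_zero,
    sub_zero, ← two_smul ℝ, smul_smul]
  norm_num
end

section
/- For every symmetric 6×6 real matrix I and all a, b, c ∈ ℝ⁶: cᵀ (B(b, I) a) = aᵀ ((((I c) ×̄*) − B(c, I)) b). (This is the rearrangement identity used to derive the recursive form of the Christoffel symbol Γ_{kij} from the closed-form expression Γ_{kij} = Φ_kᵀ B(Φ_j, I) Φ_i.) -/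
open Matrix BigOperators

theorem aux_crossM (v w : SpatialVec) : crossM v *ᵥ w = -(crossM w *ᵥ v) := by
  ext i
  rcases i with i | i <;> fin_cases i <;>
    simp [crossM, skew3, Matrix.mulVec, dotProduct, Fin.sum_univ_three] <;> ring

theorem aux_crossBar (f v x : SpatialVec) :
    x ⬝ᵥ (crossBar f *ᵥ v) = -(f ⬝ᵥ (crossM v *ᵥ x)) := by
  simp [crossBar, crossM, skew3, Matrix.mulVec, dotProduct, Fin.sum_univ_three]
  ring

theorem aux_crossF (f v x : SpatialVec) :
    x ⬝ᵥ (crossF v *ᵥ f) = -(f ⬝ᵥ (crossM v *ᵥ x)) := by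
  rw [crossF, neg_mulVec, dotProduct_neg, mulVec_transpose, dotProduct_comm,
    ← dotProduct_mulVec]

theorem aux_symm (I : Matrix (Fin 3 ⊕ Fin 3) (Fin 3 ⊕ Fin 3) ℝ)
    (hI : I.IsSymm) (x y : SpatialVec) : x ⬝ᵥ (I *ᵥ y) = (I *ᵥ x) ⬝ᵥ y := by
  rw [dotProduct_mulVec, ← mulVec_transpose, hI.eq]

theorem aux_nsB (I : Matrix (Fin 3 ⊕ Fin 3) (Fin 3 ⊕ Fin 3) ℝ)
    (hI : I.IsSymm) (v x y : SpatialVec) :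
    x ⬝ᵥ (nsB v I *ᵥ y) = (1 / 2 : ℝ) * (-((I *ᵥ y) ⬝ᵥ (crossM v *ᵥ x))
      - (I *ᵥ v) ⬝ᵥ (crossM y *ᵥ x) - (I *ᵥ x) ⬝ᵥ (crossM v *ᵥ y)) := by
  rw [nsB, smul_mulVec, dotProduct_smul, sub_mulVec, add_mulVec, dotProduct_sub,
    dotProduct_add, ← mulVec_mulVec, ← mulVec_mulVec, aux_crossF, aux_crossBar,
    aux_symm I hI, smul_eq_mul]
  ring

/-- Rearrangement identity used to derive the recursive form of `Γ_{kij}`: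
for symmetric `I` and all `a, b, c ∈ ℝ⁶`,
`cᵀ (B(b,I) a) = aᵀ ((((I c) ×̄*) − B(c,I)) b)`. -/
theorem nsB_rearrangement (I : Matrix (Fin 3 ⊕ Fin 3) (Fin 3 ⊕ Fin 3) ℝ)
    (hI : I.IsSymm) (a b c : SpatialVec) :
    c ⬝ᵥ (nsB b I *ᵥ a) = a ⬝ᵥ ((crossBar (I *ᵥ c) - nsB c I) *ᵥ b) := by
  rw [sub_mulVec, dotProduct_sub, aux_nsB I hI, aux_nsB I hI, aux_crossBar,
    aux_crossM c b, aux_crossM c a, dotProduct_neg, dotProduct_neg]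
  rw [aux_crossM a c, aux_crossM c a, neg_neg]
  ring
end
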